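/- Let μ be an S⁺-invariant probability measure on Ω_+ = Ω × R^ℕ (R finite, (T_z) a measure-preserving ℤ^d-action on the Polish space Ω). Let μ₀ be the Ω-marginal of μ, P₀^ω the quenched RWRE path measure with continuous transition probabilities π_{0,z}(ω), and G_{1,n} = σ{ω, z_{1,…,n}}. Then the limit h(μ | μ₀ × P₀^·) := lim_{n→∞} n⁻¹ H_{G_{1,n}}(μ | μ₀ × P₀^·) exists and equals H(μ₋ × q_μ | μ₋ × p⁻), where μ₋ is the backward marginal of the bi-infinite stationary extension of μ, q_μ is the unique kernel on Ω_− supported on shifts fixing μ₋, and p⁻(η, S⁻_z η) = π_{0,z}(ω) for η = (ω, z_{−∞,0}). -/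

import Mathlib

open MeasureTheory ProbabilityTheory Filter
open scoped ENNReal MeasureTheory

-- Relative entropy `H(α|β) = ∫ log (dα/dβ) dα` if `α ≪ β`, and `+∞` otherwise.
open Classical in
noncomputable def relEnt {X : Type*} [MeasurableSpace X] (α β : Measure X) : EReal :=
  if α ≪ β then ((∫ x, Real.log ((α.rnDeriv β x).toReal) ∂α : ℝ) : EReal) else ⊤

section RWRE

variable {Ω : Type*} {d : ℕ} (T : (Fin d → ℤ) → Ω → Ω) (Rng : Finset (Fin d → ℤ))

/-- The forward shift `S⁺ : (ω, z_{1,∞}) ↦ (T_{z_1} ω, z_{2,∞})` on `Ω_+ = Ω × R^ℕ`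
(the `n`-th coordinate of a forward path is the step `z_{n+1}`). -/
def Splus (η : Ω × (ℕ → {z // z ∈ Rng})) : Ω × (ℕ → {z // z ∈ Rng}) :=
  (T (η.2 0 : Fin d → ℤ) η.1, fun n => η.2 (n + 1))

/-- The shift `S : (ω, z_{-∞,∞}) ↦ (T_{z_1} ω, (z_{i+1})_i)` on `Ω × R^ℤ`. -/
def Sbi (η : Ω × (ℤ → {z // z ∈ Rng})) : Ω × (ℤ → {z // z ∈ Rng}) :=
  (T (η.2 1 : Fin d → ℤ) η.1, fun i => η.2 (i + 1))

/-- Restriction of a bi-infinite path configuration to the forward steps `z_{1,∞}`. -/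
def fwdRestrict (η : Ω × (ℤ → {z // z ∈ Rng})) : Ω × (ℕ → {z // z ∈ Rng}) :=
  (η.1, fun n => η.2 (n + 1))

/-- Restriction of a bi-infinite path configuration to the backward steps `z_{-∞,0}`
(the `n`-th coordinate of a backward configuration is the step `z_{-n}`). -/
def bwdRestrict (η : Ω × (ℤ → {z // z ∈ Rng})) : Ω × (ℕ → {z // z ∈ Rng}) :=
  (η.1, fun n => η.2 (-(n : ℤ)))

/-- The backward shift `S⁻_z : (ω, z_{-∞,0}) ↦ (T_z ω, (z_{-∞,0}, z))` appending the
step `z` to a backward configuration. -/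
def SnegStep (z : {z // z ∈ Rng}) (η : Ω × (ℕ → {z // z ∈ Rng})) :
    Ω × (ℕ → {z // z ∈ Rng}) :=
  (T (z : Fin d → ℤ) η.1, fun n => Nat.rec z (fun m _ => η.2 m) n)

/-- The restriction `(ω, z_{1,∞}) ↦ (ω, z_{1,n})` generating the σ-algebra
`G_{1,n} = σ{ω, z_{1,…,n}}`. -/
def truncPath (n : ℕ) (η : Ω × (ℕ → {z // z ∈ Rng})) : Ω × (Fin n → {z // z ∈ Rng}) :=
  (η.1, fun i => η.2 i)

end RWRE

section ConditionalEntropy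

variable {X Y A B C E : Type*} [MeasurableSpace X] [MeasurableSpace Y] [MeasurableSpace E]
  [MeasurableSpace A] [MeasurableSpace B] [MeasurableSpace C]

lemma relEnt_map_of_measurableEmbedding (α β : Measure X) [SigmaFinite α] [SigmaFinite β]
    {f : X → Y} (hf : MeasurableEmbedding f) :
    relEnt (α.map f) (β.map f) = relEnt α β := by
  have hac : α.map f ≪ β.map f ↔ α ≪ β := by
    refine ⟨fun h => Measure.AbsolutelyContinuous.mk fun s _ hs => ?_,
      hf.absolutelyContinuous_map⟩
    have := @h (f '' s)
    rw [hf.map_apply, hf.map_apply, hf.injective.preimage_image] at this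
    exact this hs
  unfold relEnt
  by_cases h : α ≪ β
  · rw [if_pos (hac.2 h), if_pos h, hf.integral_map]
    congr 1
    refine integral_congr_ae ?_
    filter_upwards [h.ae_le (hf.rnDeriv_map α β)] with x hx
    rw [hx]
  · rw [if_neg (hac.not.2 h), if_neg h]

lemma map_count_measurableEquiv [MeasurableSingletonClass A] [Countable C]
    [MeasurableSingletonClass C] (e : A ≃ᵐ C) :
    (Measure.count : Measure A).map e = Measure.count := by
  refine Measure.ext_of_singleton fun c => ?_
  have h : e ⁻¹' {c} = {e.symm c} := Set.ext fun a => (e.toEquiv.eq_symm_apply).symm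
  rw [e.map_apply, h, Measure.count_singleton, Measure.count_singleton]

lemma isFiniteMeasure_withDensity_of_le_one (μ : Measure X) [IsFiniteMeasure μ] {f : X → ℝ≥0∞}
    (hf : ∀ x, f x ≤ 1) : IsFiniteMeasure (μ.withDensity f) := by
  refine isFiniteMeasure_withDensity (ne_top_of_le_ne_top (measure_ne_top μ Set.univ) ?_)
  exact (lintegral_mono hf).trans_eq (by simp)

/-- Minus the conditional entropy of the second coordinate given the first one, for the joint law
`α` of the two coordinates. -/
noncomputable def condNegEntropy (α : Measure (X × A)) : ℝ :=
  ∫ x, Real.log ((α.rnDeriv (α.fst.prod Measure.count) x).toReal) ∂α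

variable [Finite A] [MeasurableSingletonClass A]

lemma measurable_uncurry_kernel_singleton (κ : Kernel X A) :
    Measurable fun x : X × A => κ x.1 {x.2} :=
  measurable_from_prod_countable_left fun a => κ.measurable_coe (measurableSet_singleton a)

lemma compProd_eq_withDensity_count (μ : Measure X) [SFinite μ] (κ : Kernel X A)
    [IsSFiniteKernel κ] :
    μ ⊗ₘ κ = (μ.prod Measure.count).withDensity fun x => κ x.1 {x.2} := by
  have := Fintype.ofFinite A
  have hm := measurable_uncurry_kernel_singleton κ
  ext s hs
  rw [Measure.compProd_apply hs, withDensity_apply _ hs, ← lintegral_indicator hs,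
    lintegral_prod _ (hm.indicator hs).aemeasurable]
  refine lintegral_congr fun x => ?_
  rw [lintegral_count, tsum_fintype, ← lintegral_indicator_one (measurable_prodMk_left hs),
    lintegral_fintype]
  refine Finset.sum_congr rfl fun a _ => ?_
  by_cases h : (x, a) ∈ s <;> simp [h]

variable [Nonempty A]

lemma eq_withDensity_condKernel (α : Measure (X × A)) [IsFiniteMeasure α] :
    α = (α.fst.prod Measure.count).withDensity fun x => α.condKernel x.1 {x.2} := by
  rw [← compProd_eq_withDensity_count, α.disintegrate]

lemma rnDeriv_fst_prod_count_ae_eq (α : Measure (X × A)) [IsFiniteMeasure α] :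
    α.rnDeriv (α.fst.prod Measure.count) =ᵐ[α.fst.prod Measure.count]
      fun x => α.condKernel x.1 {x.2} := by
  have h := Measure.rnDeriv_withDensity (α.fst.prod Measure.count)
    (measurable_uncurry_kernel_singleton α.condKernel)
  rwa [← eq_withDensity_condKernel] at h

lemma absolutelyContinuous_fst_prod_count (α : Measure (X × A)) [IsFiniteMeasure α] :
    α ≪ α.fst.prod Measure.count := by
  conv_lhs => rw [eq_withDensity_condKernel α]
  exact withDensity_absolutelyContinuous _ _

lemma integrable_negMulLog_condKernel (α : Measure (X × A)) [IsFiniteMeasure α] :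
    Integrable (fun x => Real.negMulLog ((α.condKernel x.1).real {x.2}))
      (α.fst.prod Measure.count) := by
  refine Integrable.of_bound (C := 1) ?_ (ae_of_all _ fun x => ?_)
  · exact (Real.continuous_negMulLog.measurable.comp
      (measurable_uncurry_kernel_singleton _).ennreal_toReal).aestronglyMeasurable
  · have h0 : 0 ≤ (α.condKernel x.1).real {x.2} := measureReal_nonneg
    have h1 : (α.condKernel x.1).real {x.2} ≤ 1 := measureReal_le_one
    rw [Real.norm_of_nonneg (Real.negMulLog_nonneg h0 h1)]
    exact (Real.negMulLog_le_one_sub_self h0).trans (by linarith)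

lemma rnDeriv_smul_log_ae_eq (α : Measure (X × A)) [IsFiniteMeasure α] :
    (fun x => (α.rnDeriv (α.fst.prod Measure.count) x).toReal •
      Real.log ((α.rnDeriv (α.fst.prod Measure.count) x).toReal))
      =ᵐ[α.fst.prod Measure.count]
      fun x => - Real.negMulLog ((α.condKernel x.1).real {x.2}) := by
  filter_upwards [rnDeriv_fst_prod_count_ae_eq α] with x hx
  simp [hx, Real.negMulLog, Measure.real]

lemma integrable_log_rnDeriv_fst_prod_count (α : Measure (X × A)) [IsFiniteMeasure α] :
    Integrable (fun x => Real.log ((α.rnDeriv (α.fst.prod Measure.count) x).toReal)) α := by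
  rw [← integrable_rnDeriv_smul_iff (absolutelyContinuous_fst_prod_count α),
    integrable_congr (rnDeriv_smul_log_ae_eq α)]
  exact (integrable_negMulLog_condKernel α).neg

lemma condNegEntropy_eq_sum_condKernel [Fintype A] (α : Measure (X × A)) [IsFiniteMeasure α] :
    condNegEntropy α = - ∑ a, ∫ x, Real.negMulLog ((α.condKernel x).real {a}) ∂α.fst := by
  have hi := integrable_negMulLog_condKernel α
  rw [condNegEntropy, ← integral_rnDeriv_smul (absolutelyContinuous_fst_prod_count α),
    integral_congr_ae (rnDeriv_smul_log_ae_eq α), integral_neg, integral_prod_symm _ hi,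
    integral_fintype .of_finite]
  simp

lemma condNegEntropy_map_prodMk [Fintype A] (P : Measure E) [IsFiniteMeasure P] {U : E → X}
    {V : E → A} (hU : Measurable U) (hV : Measurable V) :
    condNegEntropy (P.map fun e => (U e, V e))
      = - ∑ a, ∫ e, Real.negMulLog
          ((P[(V ⁻¹' {a}).indicator (fun _ => (1 : ℝ)) | MeasurableSpace.comap U inferInstance]) e)
          ∂P := by
  rw [condNegEntropy_eq_sum_condKernel]
  congr 1
  refine Finset.sum_congr rfl fun a _ => ?_
  rw [Measure.fst_map_prodMk hV, integral_map hU.aemeasurable]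
  · refine integral_congr_ae ?_
    filter_upwards [condDistrib_ae_eq_condExp (μ := P) hU hV (measurableSet_singleton a)] with e he
    rw [condDistrib] at he
    exact congrArg _ he
  · exact (Real.continuous_negMulLog.measurable.comp
      ((Kernel.measurable_coe _ (measurableSet_singleton a)).ennreal_toReal)).aestronglyMeasurable

lemma condNegEntropy_map_left (α : Measure (X × A)) [IsFiniteMeasure α] {φ : X → Y}
    (hφ : MeasurableEmbedding φ) :
    condNegEntropy (α.map (Prod.map φ id)) = condNegEntropy α := by
  have hf : MeasurableEmbedding (Prod.map φ (id : A → A)) := hφ.prodMap .id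
  have hfst : (α.map (Prod.map φ id)).fst.prod Measure.count
      = (α.fst.prod (Measure.count : Measure A)).map (Prod.map φ id) := by
    rw [← Measure.map_prod_map _ _ hφ.measurable measurable_id, Measure.map_id]
    congr 1
    rw [Measure.fst, Measure.fst, Measure.map_map measurable_fst hf.measurable,
      Measure.map_map hφ.measurable measurable_fst]
    rfl
  rw [condNegEntropy, condNegEntropy, hfst, hf.integral_map]
  refine integral_congr_ae ?_
  filter_upwards [(absolutelyContinuous_fst_prod_count α).ae_le (hf.rnDeriv_map α _)] with x hx
  rw [hx]

lemma condNegEntropy_chain_rule [Finite B] [MeasurableSingletonClass B] [Nonempty B]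
    [Finite C] [MeasurableSingletonClass C] (e : A × B ≃ᵐ C)
    (γ : Measure ((X × A) × B)) [IsFiniteMeasure γ] :
    condNegEntropy (γ.map fun y => (y.1.1, e (y.1.2, y.2)))
      = condNegEntropy γ.fst + condNegEntropy γ := by
  have hf : MeasurableEmbedding fun y : (X × A) × B => (y.1.1, e (y.1.2, y.2)) :=
    (MeasurableEquiv.prodAssoc.trans
      ((MeasurableEquiv.refl X).prodCongr e)).measurableEmbedding
  have hbase : (γ.map fun y => (y.1.1, e (y.1.2, y.2))).fst.prod Measure.count
      = ((γ.fst.fst.prod Measure.count).prod Measure.count).map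
        fun y : (X × A) × B => (y.1.1, e (y.1.2, y.2)) := by
    have h1 : (γ.map fun y => (y.1.1, e (y.1.2, y.2))).fst = γ.fst.fst := by
      simp only [Measure.fst]
      rw [Measure.map_map measurable_fst hf.measurable,
        Measure.map_map measurable_fst measurable_fst]
      rfl
    have h2 : (fun y : (X × A) × B => (y.1.1, e (y.1.2, y.2)))
        = Prod.map id e ∘ MeasurableEquiv.prodAssoc := rfl
    have h3 : (Measure.count : Measure (A × B)) = Measure.count.prod Measure.count := by
      refine Measure.ext_of_singleton fun c => ?_
      rw [← Set.singleton_prod_singleton, Measure.prod_prod, Set.singleton_prod_singleton]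
      simp
    rw [h1, h2, ← Measure.map_map (measurable_id.prodMap e.measurable)
      MeasurableEquiv.prodAssoc.measurable, Measure.prodAssoc_prod, ← h3,
      ← Measure.map_prod_map _ _ measurable_id e.measurable, Measure.map_id,
      map_count_measurableEquiv]
  set base := (γ.fst.fst.prod (Measure.count : Measure A)).prod (Measure.count : Measure B)
  have hmid : (γ.fst.prod (Measure.count : Measure B)).rnDeriv base =ᵐ[base]
      fun y => γ.fst.rnDeriv (γ.fst.fst.prod Measure.count) y.1 := by
    have h : γ.fst.prod (Measure.count : Measure B) = base.withDensity
        fun y => γ.fst.rnDeriv (γ.fst.fst.prod Measure.count) y.1 := by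
      rw [← prod_withDensity_left (Measure.measurable_rnDeriv _ _),
        Measure.withDensity_rnDeriv_eq _ _ (absolutelyContinuous_fst_prod_count γ.fst)]
    rw [h]
    exact Measure.rnDeriv_withDensity _ ((Measure.measurable_rnDeriv _ _).comp measurable_fst)
  have hac1 := absolutelyContinuous_fst_prod_count γ
  have hac2 : γ.fst.prod (Measure.count : Measure B) ≪ base :=
    (absolutelyContinuous_fst_prod_count γ.fst).prod Measure.AbsolutelyContinuous.rfl
  have hac := hac1.trans hac2
  have hint1 := integrable_log_rnDeriv_fst_prod_count γ.fst
  have hfstmap : γ.fst = γ.map Prod.fst := rfl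
  have hint1' : Integrable (fun y : (X × A) × B =>
      Real.log ((γ.fst.rnDeriv (γ.fst.fst.prod Measure.count) y.1).toReal)) γ :=
    hint1.comp_measurable (f := Prod.fst) measurable_fst
  have hint2 := integrable_log_rnDeriv_fst_prod_count γ
  have hfirst : condNegEntropy γ.fst = ∫ y,
      Real.log ((γ.fst.rnDeriv (γ.fst.fst.prod Measure.count) y.1).toReal) ∂γ := by
    rw [condNegEntropy]
    conv_lhs => rw [hfstmap]
    rw [integral_map measurable_fst.aemeasurable]
    · rfl
    · exact (Real.measurable_log.comp
        (Measure.measurable_rnDeriv _ _).ennreal_toReal).aestronglyMeasurable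
  rw [hfirst, condNegEntropy, condNegEntropy, hbase, hf.integral_map,
    ← integral_add hint1' hint2]
  refine integral_congr_ae ?_
  have hpos2 : ∀ᵐ y ∂γ, γ.fst.rnDeriv (γ.fst.fst.prod Measure.count) y.1 ≠ 0 :=
    ae_of_ae_map measurable_fst.aemeasurable
      ((Measure.rnDeriv_pos (absolutelyContinuous_fst_prod_count γ.fst)).mono fun _ h => h.ne')
  have hfin2 : ∀ᵐ y ∂γ, γ.fst.rnDeriv (γ.fst.fst.prod Measure.count) y.1 ≠ ∞ :=
    ae_of_ae_map measurable_fst.aemeasurable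
      ((absolutelyContinuous_fst_prod_count γ.fst).ae_le (Measure.rnDeriv_ne_top _ _))
  filter_upwards [hac.ae_le (hf.rnDeriv_map γ base), hac.ae_le hmid,
    hac.ae_le (Measure.rnDeriv_mul_rnDeriv (κ := base) hac1), Measure.rnDeriv_pos hac1,
    hac1.ae_le (Measure.rnDeriv_ne_top γ _), hpos2, hfin2] with y h1 h2 h3 h4 h5 h6 h7
  rw [h1, ← h3, Pi.mul_apply, h2, ENNReal.toReal_mul, Real.log_mul, add_comm]
  · exact (ENNReal.toReal_pos h4.ne' h5).ne'
  · exact (ENNReal.toReal_pos h6 h7).ne'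

open Classical in
lemma relEnt_withDensity_fst_prod_count (α : Measure (X × A)) [IsFiniteMeasure α]
    {ρ : X × A → ℝ≥0∞} (hρ : Measurable ρ) (hρ1 : ∀ x, ρ x ≤ 1) :
    relEnt α ((α.fst.prod Measure.count).withDensity ρ)
      = if ∀ᵐ x ∂α, ρ x ≠ 0 then
          if Integrable (fun x => - Real.log (ρ x).toReal) α then
            ((condNegEntropy α + ∫ x, - Real.log (ρ x).toReal ∂α : ℝ) : EReal)
          else 0
        else ⊤ := by
  set base := α.fst.prod (Measure.count : Measure A)
  set β := base.withDensity ρ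
  have hbase := absolutelyContinuous_fst_prod_count α
  have : IsFiniteMeasure β := isFiniteMeasure_withDensity_of_le_one base hρ1
  have hac : α ≪ β ↔ ∀ᵐ x ∂α, ρ x ≠ 0 := by
    refine ⟨fun h => h.ae_le ?_, fun h => Measure.AbsolutelyContinuous.mk fun s hs h0 => ?_⟩
    · change ∀ᵐ x ∂β, ρ x ≠ 0
      rw [ae_withDensity_iff hρ]
      exact ae_of_all _ fun _ h => h
    · rw [withDensity_apply_eq_zero hρ] at h0
      have h1 := hbase h0
      rw [measure_eq_zero_iff_ae_notMem] at h1 ⊢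
      filter_upwards [h, h1] with x hx hx1 hxs using hx1 ⟨hx, hxs⟩
  unfold relEnt
  by_cases h : α ≪ β
  swap
  · rw [if_neg h, if_neg (hac.not.1 h)]
  rw [if_pos h, if_pos (hac.1 h)]
  have hlog : (fun x => Real.log ((α.rnDeriv β x).toReal)) =ᵐ[α]
      fun x => Real.log ((α.rnDeriv base x).toReal) + - Real.log (ρ x).toReal := by
    filter_upwards [hbase.ae_le (Measure.rnDeriv_mul_rnDeriv (κ := base) h),
      hbase.ae_le (Measure.rnDeriv_withDensity base hρ), hac.1 h, Measure.rnDeriv_pos h,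
      h.ae_le (Measure.rnDeriv_ne_top α β)] with x h1 h2 h3 h4 h5
    rw [← h1, Pi.mul_apply, h2, ENNReal.toReal_mul, Real.log_mul]
    · ring
    · exact (ENNReal.toReal_pos h4.ne' h5).ne'
    · exact (ENNReal.toReal_pos h3 (ne_top_of_le_ne_top ENNReal.one_ne_top (hρ1 x))).ne'
  have hint := integrable_log_rnDeriv_fst_prod_count α
  rw [integral_congr_ae hlog]
  split_ifs with hi
  · rw [integral_add hint hi]
    rfl
  · rw [integral_undef]
    · rfl
    · rwa [integrable_add_iff_integrable_right' hint]

lemma tendsto_condNegEntropy_of_iSup_comap {Xs : ℕ → Type*} [∀ n, MeasurableSpace (Xs n)]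
    (P : Measure E) [IsProbabilityMeasure P] {U : ∀ n, E → Xs n} (hU : ∀ n, Measurable (U n))
    (hmono : Monotone fun n => MeasurableSpace.comap (U n) inferInstance)
    {W : E → Y} (hW : Measurable W)
    (hsup : ⨆ n, MeasurableSpace.comap (U n) inferInstance = MeasurableSpace.comap W inferInstance)
    {V : E → A} (hV : Measurable V) :
    Tendsto (fun n => condNegEntropy (P.map fun e => (U n e, V e))) atTop
      (nhds (condNegEntropy (P.map fun e => (W e, V e)))) := by
  have := Fintype.ofFinite A
  let ℱ : Filtration ℕ (inferInstance : MeasurableSpace E) :=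
    ⟨fun n => MeasurableSpace.comap (U n) inferInstance, hmono, fun n => (hU n).comap_le⟩
  simp_rw [condNegEntropy_map_prodMk P (hU _) hV, condNegEntropy_map_prodMk P hW hV, ← hsup]
  refine (tendsto_finsetSum _ fun a _ => ?_).neg
  set f : E → ℝ := (V ⁻¹' {a}).indicator fun _ => (1 : ℝ)
  have hf : Integrable f P :=
    (integrable_const 1).indicator (hV (measurableSet_singleton a))
  have hf0 : 0 ≤ f := fun e => Set.indicator_nonneg (fun _ _ => zero_le_one) e
  have hf1 : f ≤ fun _ => 1 := fun e => Set.indicator_le_self' (fun _ _ => zero_le_one) e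
  refine tendsto_integral_of_dominated_convergence (fun _ => 1) (fun n => ?_)
    (integrable_const 1) (fun n => ?_) ?_
  · exact Real.continuous_negMulLog.comp_aestronglyMeasurable
      integrable_condExp.aestronglyMeasurable
  · have h1 := condExp_mono (m := ℱ n) hf (integrable_const 1) (ae_of_all P hf1)
    rw [condExp_const (ℱ.le n)] at h1
    filter_upwards [h1, condExp_nonneg (m := ℱ n) (ae_of_all P hf0)] with e h1 h0
    rw [Real.norm_of_nonneg (Real.negMulLog_nonneg h0 h1)]
    exact (Real.negMulLog_le_one_sub_self h0).trans (sub_le_self 1 h0)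
  · filter_upwards [tendsto_ae_condExp (ℱ := ℱ) (μ := P) f] with e he
    exact (Real.continuous_negMulLog.tendsto _).comp he

open Classical in
lemma relEnt_map_withDensity_fst_prod_count (P : Measure E) [IsFiniteMeasure P] {W : E → X × A}
    (hW : Measurable W) {ρ : X × A → ℝ≥0∞} (hρ : Measurable ρ) (hρ1 : ∀ x, ρ x ≤ 1) :
    relEnt (P.map W) (((P.map W).fst.prod Measure.count).withDensity ρ)
      = if ∀ᵐ e ∂P, ρ (W e) ≠ 0 then
          if Integrable (fun e => - Real.log (ρ (W e)).toReal) P then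
            ((condNegEntropy (P.map W) + ∫ e, - Real.log (ρ (W e)).toReal ∂P : ℝ) : EReal)
          else 0
        else ⊤ := by
  have hm : Measurable fun x => - Real.log (ρ x).toReal :=
    (Real.measurable_log.comp hρ.ennreal_toReal).neg
  have hs : MeasurableSet {x | ρ x ≠ 0} := (hρ (measurableSet_singleton 0)).compl
  rw [relEnt_withDensity_fst_prod_count _ hρ hρ1, integral_map hW.aemeasurable
    hm.aestronglyMeasurable, integrable_map_measure hm.aestronglyMeasurable hW.aemeasurable,
    ae_map_iff hW.aemeasurable hs]
  rfl

end ConditionalEntropy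

section Environment

variable {Ω : Type*} {d : ℕ} {T : (Fin d → ℤ) → Ω → Ω}
  {Rng : Finset (Fin d → ℤ)}

lemma Sbi_iterate (hT0 : T 0 = id) (hTadd : ∀ a b : Fin d → ℤ, T (a + b) = T a ∘ T b) (k : ℕ)
    (η : Ω × (ℤ → {z // z ∈ Rng})) :
    (Sbi T Rng)^[k] η
      = (T (∑ i ∈ Finset.range k, (η.2 (i + 1) : Fin d → ℤ)) η.1, fun i => η.2 (i + k)) := by
  induction k with
  | zero => simp [hT0]
  | succ k ih =>
    rw [Function.iterate_succ_apply', ih, Sbi, Finset.sum_range_succ, add_comm (Finset.sum _ _),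
      hTadd]
    refine Prod.ext ?_ (funext fun i => ?_)
    · simp [add_comm]
    · exact congrArg η.2 (by push_cast; ring)

lemma bwdRestrict_Sbi (η : Ω × (ℤ → {z // z ∈ Rng})) :
    bwdRestrict Rng (Sbi T Rng η) = SnegStep T Rng (η.2 1) (bwdRestrict Rng η) := by
  refine Prod.ext rfl (funext fun n => ?_)
  cases n with
  | zero => simp [bwdRestrict, Sbi, SnegStep]
  | succ m => simp [bwdRestrict, Sbi, SnegStep]

/-- The inverse of the backward shifts: it forgets the last step of a backward configuration. -/
def SnegUndo (T : (Fin d → ℤ) → Ω → Ω) (Rng : Finset (Fin d → ℤ))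
    (ζ : Ω × (ℕ → {z // z ∈ Rng})) : Ω × (ℕ → {z // z ∈ Rng}) :=
  (T (-(ζ.2 0 : Fin d → ℤ)) ζ.1, fun n => ζ.2 (n + 1))

lemma SnegUndo_SnegStep (hT0 : T 0 = id) (hTadd : ∀ a b : Fin d → ℤ, T (a + b) = T a ∘ T b)
    (z : {z // z ∈ Rng}) (η : Ω × (ℕ → {z // z ∈ Rng})) :
    SnegUndo T Rng (SnegStep T Rng z η) = η := by
  refine Prod.ext ?_ rfl
  change (T (-(z : Fin d → ℤ)) ∘ T z) η.1 = η.1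
  rw [← hTadd, neg_add_cancel, hT0, id]

/-- A backward configuration together with its continuation by one step. -/
def SnegPair (T : (Fin d → ℤ) → Ω → Ω) (Rng : Finset (Fin d → ℤ))
    (x : (Ω × (ℕ → {z // z ∈ Rng})) × {z // z ∈ Rng}) :
    (Ω × (ℕ → {z // z ∈ Rng})) × (Ω × (ℕ → {z // z ∈ Rng})) :=
  (x.1, SnegStep T Rng x.2 x.1)

/-- The environment and the first `k` forward steps. -/
def fwdPath (Rng : Finset (Fin d → ℤ)) (k : ℕ) (η : Ω × (ℤ → {z // z ∈ Rng})) :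
    Ω × (Fin k → {z // z ∈ Rng}) :=
  (η.1, fun i => η.2 (i + 1))

/-- The environment and the last `k` backward steps. -/
def bwdPath (Rng : Finset (Fin d → ℤ)) (k : ℕ) (η : Ω × (ℤ → {z // z ∈ Rng})) :
    Ω × (Fin k → {z // z ∈ Rng}) :=
  (η.1, fun i => η.2 (-(i : ℤ)))

lemma truncPath_comp_bwdRestrict (k : ℕ) :
    truncPath Rng k ∘ bwdRestrict Rng = (bwdPath Rng k : Ω × (ℤ → {z // z ∈ Rng}) → _) := rfl

lemma truncPath_comp_fwdRestrict (k : ℕ) :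
    truncPath Rng k ∘ fwdRestrict Rng = (fwdPath Rng k : Ω × (ℤ → {z // z ∈ Rng}) → _) := rfl

/-- Seen from the end of the path, a forward path becomes a backward path. -/
def reversePath (T : (Fin d → ℤ) → Ω → Ω) (Rng : Finset (Fin d → ℤ)) (k : ℕ)
    (x : Ω × (Fin k → {z // z ∈ Rng})) : Ω × (Fin k → {z // z ∈ Rng}) :=
  (T (∑ i, (x.2 i : Fin d → ℤ)) x.1, fun i => x.2 i.rev)

lemma bwdPath_Sbi_iterate (hT0 : T 0 = id)
    (hTadd : ∀ a b : Fin d → ℤ, T (a + b) = T a ∘ T b) (k : ℕ)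
    (η : Ω × (ℤ → {z // z ∈ Rng})) :
    bwdPath Rng k ((Sbi T Rng)^[k] η) = reversePath T Rng k (fwdPath Rng k η) := by
  rw [Sbi_iterate hT0 hTadd]
  refine Prod.ext ?_ (funext fun i => ?_)
  · simp only [bwdPath, reversePath, fwdPath]
    rw [Fin.sum_univ_eq_sum_range fun i : ℕ => (η.2 (i + 1) : Fin d → ℤ)]
  · simp only [bwdPath, reversePath, fwdPath, Fin.val_rev]
    have := i.2
    exact congrArg η.2 (by omega)

variable [MeasurableSpace Ω]

lemma measurable_uncurry_action (hT : ∀ a, Measurable (T a)) :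
    Measurable fun x : Ω × (Fin d → ℤ) => T x.2 x.1 :=
  measurable_from_prod_countable_left hT

lemma measurable_Sbi (hT : ∀ a, Measurable (T a)) : Measurable (Sbi T Rng) := by
  refine Measurable.prodMk ((measurable_uncurry_action hT).comp
    (g := fun x : Ω × (Fin d → ℤ) => T x.2 x.1)
    (f := fun η : Ω × (ℤ → {z // z ∈ Rng}) => (η.1, (η.2 1 : Fin d → ℤ))) ?_) ?_ <;> fun_prop

lemma measurable_SnegStep (hT : ∀ a, Measurable (T a)) (z : {z // z ∈ Rng}) :
    Measurable (SnegStep T Rng z) := by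
  refine Measurable.prodMk ((hT z).comp measurable_fst) (measurable_pi_lambda _ fun n => ?_)
  cases n with
  | zero => exact measurable_const
  | succ m => exact (measurable_pi_apply m).comp measurable_snd

lemma measurable_fwdRestrict : Measurable (fwdRestrict Rng : Ω × (ℤ → {z // z ∈ Rng}) → _) := by
  unfold fwdRestrict; fun_prop

lemma measurable_bwdRestrict : Measurable (bwdRestrict Rng : Ω × (ℤ → {z // z ∈ Rng}) → _) := by
  unfold bwdRestrict; fun_prop

lemma measurable_truncPath (n : ℕ) :
    Measurable (truncPath Rng n : Ω × (ℕ → {z // z ∈ Rng}) → _) := by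
  unfold truncPath; fun_prop

lemma measurable_SnegUndo (hT : ∀ a, Measurable (T a)) : Measurable (SnegUndo T Rng) := by
  refine Measurable.prodMk ((measurable_uncurry_action hT).comp
    (g := fun x : Ω × (Fin d → ℤ) => T x.2 x.1)
    (f := fun ζ : Ω × (ℕ → {z // z ∈ Rng}) => (ζ.1, -(ζ.2 0 : Fin d → ℤ))) ?_) ?_ <;> fun_prop

lemma measurable_SnegPair (hT : ∀ a, Measurable (T a)) : Measurable (SnegPair T Rng) :=
  measurable_fst.prodMk
    (measurable_from_prod_countable_left fun z => measurable_SnegStep hT z)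

lemma measurableEmbedding_SnegPair [StandardBorelSpace Ω] (hT : ∀ a, Measurable (T a)) :
    MeasurableEmbedding (SnegPair T Rng) := by
  have : StandardBorelSpace (Ω × (ℕ → {z // z ∈ Rng})) := inferInstance
  have : StandardBorelSpace ((Ω × (ℕ → {z // z ∈ Rng})) × (Ω × (ℕ → {z // z ∈ Rng}))) :=
    inferInstance
  refine (measurable_SnegPair hT).measurableEmbedding fun x y h => ?_
  have h2 : (SnegStep T Rng x.2 x.1).2 0 = (SnegStep T Rng y.2 y.1).2 0 :=
    congrArg (fun p => p.2.2 0) h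
  exact Prod.ext (congrArg (fun p => p.1) h : (SnegPair T Rng x).1 = (SnegPair T Rng y).1) h2

lemma measurable_fwdPath (k : ℕ) :
    Measurable (fwdPath Rng k : Ω × (ℤ → {z // z ∈ Rng}) → _) := by
  unfold fwdPath; fun_prop

lemma measurable_bwdPath (k : ℕ) :
    Measurable (bwdPath Rng k : Ω × (ℤ → {z // z ∈ Rng}) → _) := by
  unfold bwdPath; fun_prop

lemma monotone_comap_bwdPath :
    Monotone fun k => MeasurableSpace.comap
      (bwdPath Rng k : Ω × (ℤ → {z // z ∈ Rng}) → _) inferInstance := by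
  intro k l hkl
  let res : Ω × (Fin l → {z // z ∈ Rng}) → Ω × (Fin k → {z // z ∈ Rng}) :=
    fun x => (x.1, fun i => x.2 (Fin.castLE hkl i))
  have hres : Measurable res := by fun_prop
  change MeasurableSpace.comap (res ∘ bwdPath Rng l) _ ≤ _
  rw [← MeasurableSpace.comap_comp]
  exact MeasurableSpace.comap_mono hres.comap_le

lemma measurable_bwdRestrict_comp {E : Type*} {mE : MeasurableSpace E}
    {f : E → Ω × (ℤ → {z // z ∈ Rng})} (hf : ∀ k, Measurable fun e => bwdPath Rng k (f e)) :
    Measurable fun e => bwdRestrict Rng (f e) :=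
  (hf 0).fst.prodMk
    (measurable_pi_lambda _ fun n => measurable_pi_iff.1 (hf (n + 1)).snd (Fin.last n))

lemma iSup_comap_bwdPath :
    ⨆ k, MeasurableSpace.comap (bwdPath Rng k : Ω × (ℤ → {z // z ∈ Rng}) → _) inferInstance
      = MeasurableSpace.comap (bwdRestrict Rng) inferInstance := by
  refine le_antisymm (iSup_le fun k => ?_) ?_
  · rw [← truncPath_comp_bwdRestrict, ← MeasurableSpace.comap_comp]
    exact MeasurableSpace.comap_mono (measurable_truncPath k).comap_le
  · rw [← measurable_iff_comap_le]
    have hk : ∀ k, Measurable[⨆ k, MeasurableSpace.comap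
        (bwdPath Rng k : Ω × (ℤ → {z // z ∈ Rng}) → _) inferInstance] (bwdPath Rng k) := fun k =>
      (comap_measurable (bwdPath Rng k)).mono (le_iSup (fun k => MeasurableSpace.comap
        (bwdPath Rng k : Ω × (ℤ → {z // z ∈ Rng}) → _) inferInstance) k) le_rfl
    exact measurable_bwdRestrict_comp (mE := _) (f := id) hk

lemma measurableEmbedding_reversePath [StandardBorelSpace Ω] (hT : ∀ a, Measurable (T a))
    (hT0 : T 0 = id) (hTadd : ∀ a b : Fin d → ℤ, T (a + b) = T a ∘ T b) (k : ℕ) :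
    MeasurableEmbedding (reversePath T Rng k) := by
  refine Measurable.measurableEmbedding ?_ fun x y h => ?_
  · refine Measurable.prodMk ((measurable_uncurry_action hT).comp
      (g := fun x : Ω × (Fin d → ℤ) => T x.2 x.1)
      (f := fun x : Ω × (Fin k → {z // z ∈ Rng}) => (x.1, ∑ i, (x.2 i : Fin d → ℤ))) ?_) ?_ <;>
      fun_prop
  · have h2 : x.2 = y.2 := funext fun i => by
      simpa [reversePath] using congrFun (congrArg Prod.snd h) i.rev
    have h1 : T (∑ i, (x.2 i : Fin d → ℤ)) x.1 = T (∑ i, (y.2 i : Fin d → ℤ)) y.1 :=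
      congrArg Prod.fst h
    rw [← h2] at h1
    have hinj : Function.Injective (T (∑ i, (x.2 i : Fin d → ℤ))) := by
      refine Function.LeftInverse.injective (g := T (-∑ i, (x.2 i : Fin d → ℤ))) fun ω => ?_
      rw [← Function.comp_apply (f := T _), ← hTadd, neg_add_cancel, hT0, id]
    exact Prod.ext (hinj h1) h2

variable {P : Measure (Ω × (ℤ → {z // z ∈ Rng}))}

lemma condNegEntropy_fwdPath_step [StandardBorelSpace Ω] [IsProbabilityMeasure P]
    (hT : ∀ a, Measurable (T a)) (hT0 : T 0 = id)
    (hTadd : ∀ a b : Fin d → ℤ, T (a + b) = T a ∘ T b)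
    (hP : MeasurePreserving (Sbi T Rng) P P) (k : ℕ) :
    condNegEntropy (P.map fun η => (fwdPath Rng k η, η.2 (k + 1)))
      = condNegEntropy (P.map fun η => (bwdPath Rng k η, η.2 1)) := by
  have hf : Measurable fun η : Ω × (ℤ → {z // z ∈ Rng}) => (fwdPath Rng k η, η.2 (k + 1)) :=
    (measurable_fwdPath k).prodMk (by fun_prop)
  have hb : Measurable fun η : Ω × (ℤ → {z // z ∈ Rng}) => (bwdPath Rng k η, η.2 1) :=
    (measurable_bwdPath k).prodMk (by fun_prop)
  have hemb := measurableEmbedding_reversePath (Rng := Rng) hT hT0 hTadd k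
  have : Nonempty (Ω × (ℤ → {z // z ∈ Rng})) := nonempty_of_isProbabilityMeasure P
  have : Nonempty {z // z ∈ Rng} := this.map fun η => η.2 0
  rw [← condNegEntropy_map_left _ hemb]
  congr 1
  rw [Measure.map_map (hemb.measurable.prodMap measurable_id) hf]
  conv_rhs => rw [← (hP.iterate k).map_eq, Measure.map_map hb (hP.iterate k).measurable]
  congr 1
  funext η
  simp only [Function.comp, Prod.map, id]
  rw [bwdPath_Sbi_iterate hT0 hTadd, Sbi_iterate hT0 hTadd, add_comm]

lemma condNegEntropy_fwdPath_succ [StandardBorelSpace Ω] [IsProbabilityMeasure P]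
    (hT : ∀ a, Measurable (T a)) (hT0 : T 0 = id)
    (hTadd : ∀ a b : Fin d → ℤ, T (a + b) = T a ∘ T b)
    (hP : MeasurePreserving (Sbi T Rng) P P) (k : ℕ) :
    condNegEntropy (P.map (fwdPath Rng (k + 1)))
      = condNegEntropy (P.map (fwdPath Rng k))
        + condNegEntropy (P.map fun η => (bwdPath Rng k η, η.2 1)) := by
  have : Nonempty (Ω × (ℤ → {z // z ∈ Rng})) := nonempty_of_isProbabilityMeasure P
  have : Nonempty {z // z ∈ Rng} := this.map fun η => η.2 0
  let e : (Fin k → {z // z ∈ Rng}) × {z // z ∈ Rng} ≃ᵐ (Fin (k + 1) → {z // z ∈ Rng}) :=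
    { toEquiv := (Equiv.prodComm _ _).trans (Fin.snocEquiv fun _ => {z // z ∈ Rng})
      measurable_toFun := .of_discrete
      measurable_invFun := .of_discrete }
  have hf : Measurable fun η : Ω × (ℤ → {z // z ∈ Rng}) => (fwdPath Rng k η, η.2 (k + 1)) :=
    (measurable_fwdPath k).prodMk (by fun_prop)
  have hm : Measurable fun y : (Ω × (Fin k → {z // z ∈ Rng})) × {z // z ∈ Rng} =>
      (y.1.1, e (y.1.2, y.2)) := by fun_prop
  have h := condNegEntropy_chain_rule e (P.map fun η => (fwdPath Rng k η, η.2 (k + 1)))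
  rw [Measure.map_map hm hf, Measure.fst_map_prodMk (by fun_prop),
    condNegEntropy_fwdPath_step hT hT0 hTadd hP] at h
  rw [← h]
  congr 2
  funext η
  refine Prod.ext rfl (funext fun i => ?_)
  change η.2 (i + 1) = Fin.snoc (α := fun _ => {z // z ∈ Rng})
    (fun i : Fin k => η.2 (i + 1)) (η.2 (k + 1)) i
  induction i using Fin.lastCases with
  | last => simp
  | cast i => simp

lemma tendsto_condNegEntropy_fwdPath [StandardBorelSpace Ω] [IsProbabilityMeasure P]
    (hT : ∀ a, Measurable (T a)) (hT0 : T 0 = id)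
    (hTadd : ∀ a b : Fin d → ℤ, T (a + b) = T a ∘ T b)
    (hP : MeasurePreserving (Sbi T Rng) P P) :
    Tendsto (fun n : ℕ => (n : ℝ)⁻¹ * condNegEntropy (P.map (fwdPath Rng n))) atTop
      (nhds (condNegEntropy (P.map fun η => (bwdRestrict Rng η, η.2 1)))) := by
  have : Nonempty (Ω × (ℤ → {z // z ∈ Rng})) := nonempty_of_isProbabilityMeasure P
  have : Nonempty {z // z ∈ Rng} := this.map fun η => η.2 0
  have hlim := tendsto_condNegEntropy_of_iSup_comap P (U := fun k => bwdPath Rng k)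
    (V := fun η => η.2 1) measurable_bwdPath monotone_comap_bwdPath measurable_bwdRestrict
    iSup_comap_bwdPath (by fun_prop)
  have hsum : ∀ n : ℕ, condNegEntropy (P.map (fwdPath Rng n))
      = condNegEntropy (P.map (fwdPath Rng 0))
        + ∑ k ∈ Finset.range n, condNegEntropy (P.map fun η => (bwdPath Rng k η, η.2 1)) := by
    intro n
    induction n with
    | zero => simp
    | succ n ih =>
      rw [condNegEntropy_fwdPath_succ hT hT0 hTadd hP, ih, Finset.sum_range_succ, add_assoc]
  have h0 := (tendsto_inv_atTop_nhds_zero_nat (𝕜 := ℝ)).mul_const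
    (condNegEntropy (P.map (fwdPath Rng 0)))
  rw [zero_mul] at h0
  have h := h0.add hlim.cesaro
  rw [zero_add] at h
  refine h.congr fun n => ?_
  rw [hsum n, mul_add]

end Environment

section TransitionProbabilities

variable {Ω : Type*} {d : ℕ} {T : (Fin d → ℤ) → Ω → Ω} {Rng : Finset (Fin d → ℤ)}
  {prob : {z // z ∈ Rng} → Ω → ℝ≥0∞}

lemma transition_le_one (hprobsum : ∀ ω, ∑ z : {z // z ∈ Rng}, prob z ω = 1) (z : {z // z ∈ Rng})
    (ω : Ω) : prob z ω ≤ 1 :=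
  (Finset.single_le_sum_of_canonicallyOrdered (f := fun z => prob z ω)
    (Finset.mem_univ z)).trans_eq (hprobsum ω)

/-- The quenched probability of a finite path. -/
noncomputable def pathProb (T : (Fin d → ℤ) → Ω → Ω) (prob : {z // z ∈ Rng} → Ω → ℝ≥0∞) (n : ℕ)
    (x : Ω × (Fin n → {z // z ∈ Rng})) : ℝ≥0∞ :=
  ∏ i : Fin n, prob (x.2 i) (T (∑ j ∈ Finset.univ.filter (· < i), (x.2 j : Fin d → ℤ)) x.1)

lemma pathProb_le_one (hprobsum : ∀ ω, ∑ z : {z // z ∈ Rng}, prob z ω = 1) (n : ℕ)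
    (x : Ω × (Fin n → {z // z ∈ Rng})) : pathProb T prob n x ≤ 1 :=
  Finset.prod_le_one' fun _ _ => transition_le_one hprobsum _ _

/-- The transition probability of the first forward step. -/
def stepProb (prob : {z // z ∈ Rng} → Ω → ℝ≥0∞) (η : Ω × (ℤ → {z // z ∈ Rng})) : ℝ≥0∞ :=
  prob (η.2 1) η.1

lemma pathProb_fwdPath (hT0 : T 0 = id) (hTadd : ∀ a b : Fin d → ℤ, T (a + b) = T a ∘ T b)
    (n : ℕ) (η : Ω × (ℤ → {z // z ∈ Rng})) :
    pathProb T prob n (fwdPath Rng n η)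
      = ∏ k ∈ Finset.range n, stepProb prob ((Sbi T Rng)^[k] η) := by
  rw [← Fin.prod_univ_eq_prod_range fun k => stepProb prob ((Sbi T Rng)^[k] η)]
  refine Finset.prod_congr rfl fun i _ => ?_
  rw [Sbi_iterate hT0 hTadd, stepProb]
  have hsum : ∑ j ∈ Finset.univ.filter (· < i), ((fwdPath Rng n η).2 j : Fin d → ℤ)
      = ∑ j ∈ Finset.range i, (η.2 (j + 1) : Fin d → ℤ) :=
    Finset.sum_nbij (fun j => (j : ℕ)) (fun j hj => Finset.mem_range.2 (Finset.mem_filter.1 hj).2)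
      Fin.val_injective.injOn
      (fun j hj => ⟨⟨j, (Finset.mem_range.1 hj).trans i.2⟩, by
        rw [Finset.mem_coe, Finset.mem_filter]
        exact ⟨Finset.mem_univ _, Finset.mem_range.1 hj⟩, rfl⟩)
      fun _ _ => rfl
  rw [hsum]
  change prob (η.2 (i + 1)) _ = prob (η.2 (1 + i)) _
  rw [add_comm]
  rfl

lemma neg_log_stepProb_nonneg (hprobsum : ∀ ω, ∑ z : {z // z ∈ Rng}, prob z ω = 1)
    (η : Ω × (ℤ → {z // z ∈ Rng})) : 0 ≤ - Real.log (stepProb prob η).toReal :=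
  neg_nonneg.2 (Real.log_nonpos ENNReal.toReal_nonneg
    (ENNReal.toReal_le_of_le_ofReal zero_le_one
      (by rw [ENNReal.ofReal_one]; exact transition_le_one hprobsum _ _)))

variable [MeasurableSpace Ω]

lemma measurable_pathProb (hT : ∀ a, Measurable (T a)) (hprob : ∀ z, Measurable (prob z))
    (n : ℕ) : Measurable (pathProb T prob n) :=
  measurable_from_prod_countable_left fun a =>
    Finset.measurable_prod _ fun i _ => (hprob (a i)).comp
      (hT (∑ j ∈ Finset.univ.filter (· < i), (a j : Fin d → ℤ)))

lemma measurable_stepProb (hprob : ∀ z, Measurable (prob z)) : Measurable (stepProb prob) := by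
  have h : Measurable fun x : Ω × {z // z ∈ Rng} => prob x.2 x.1 :=
    measurable_from_prod_countable_left hprob
  exact h.comp (f := fun η : Ω × (ℤ → {z // z ∈ Rng}) => (η.1, η.2 1)) (by fun_prop)

lemma map_truncPath_compProd (μ₀ : Measure Ω) [SFinite μ₀]
    (K : Kernel Ω (ℕ → {z // z ∈ Rng})) [IsMarkovKernel K]
    (hK : ∀ (ω : Ω) (n : ℕ) (a : Fin n → {z // z ∈ Rng}),
      K ω {z | ∀ i : Fin n, z i = a i}
        = ∏ i : Fin n,
            prob (a i) (T (∑ j ∈ Finset.univ.filter (· < i), (a j : Fin d → ℤ)) ω))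
    (n : ℕ) :
    (μ₀ ⊗ₘ K).map (truncPath Rng n)
      = (μ₀.prod Measure.count).withDensity (pathProb T prob n) := by
  have hr : Measurable fun (z : ℕ → {z // z ∈ Rng}) (i : Fin n) => z i := by fun_prop
  have hmap : (μ₀ ⊗ₘ K).map (truncPath Rng n) = μ₀ ⊗ₘ K.map fun z (i : Fin n) => z i := by
    rw [Measure.compProd_map hr]
    rfl
  rw [hmap, compProd_eq_withDensity_count]
  congr 1
  funext x
  rw [Kernel.map_apply' _ hr _ (measurableSet_singleton _), pathProb, ← hK]
  congr 1
  ext z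
  exact funext_iff

lemma compProd_eq_map_SnegPair (hT : ∀ a, Measurable (T a)) (hprob : ∀ z, Measurable (prob z))
    (μm : Measure (Ω × (ℕ → {z // z ∈ Rng}))) [SFinite μm]
    (pneg : Kernel (Ω × (ℕ → {z // z ∈ Rng})) (Ω × (ℕ → {z // z ∈ Rng}))) [IsSFiniteKernel pneg]
    (hpneg : ∀ η, pneg η
        = ∑ z : {z // z ∈ Rng}, (prob z η.1) • Measure.dirac (SnegStep T Rng z η)) :
    μm ⊗ₘ pneg = ((μm.prod Measure.count).withDensity fun x => prob x.2 x.1.1).map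
      (SnegPair T Rng) := by
  have hm : Measurable fun x : (Ω × (ℕ → {z // z ∈ Rng})) × {z // z ∈ Rng} => prob x.2 x.1.1 :=
    measurable_from_prod_countable_left fun z => (hprob z).comp measurable_fst
  ext s hs
  have hs' := measurable_SnegPair (Rng := Rng) hT hs
  rw [Measure.compProd_apply hs, Measure.map_apply (measurable_SnegPair hT) hs,
    withDensity_apply _ hs', ← lintegral_indicator hs',
    lintegral_prod _ (hm.indicator hs').aemeasurable]
  refine lintegral_congr fun η => ?_
  rw [lintegral_count, tsum_fintype, hpneg, Measure.finsetSum_apply]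
  refine Finset.sum_congr rfl fun z _ => ?_
  rw [Measure.smul_apply, Measure.dirac_apply' _ (measurable_prodMk_left hs)]
  by_cases h : (η, SnegStep T Rng z η) ∈ s <;> simp [Set.indicator, SnegPair, h]

lemma map_eq_map_snd_of_ae_eq {X Y : Type*} [MeasurableSpace X] [MeasurableSpace Y]
    {π : Measure (X × Y)} {g : Y → X} (hg : Measurable g) (h : ∀ᵐ p ∂π, p.1 = g p.2) :
    π = π.snd.map fun y => (g y, y) := by
  rw [Measure.snd, Measure.map_map (by fun_prop) measurable_snd]
  conv_lhs => rw [← Measure.map_id (μ := π)]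
  refine Measure.map_congr ?_
  filter_upwards [h] with p hp
  exact Prod.ext hp rfl

lemma compProd_eq_map_bwdRestrict [StandardBorelSpace Ω] (hT : ∀ a, Measurable (T a))
    (hT0 : T 0 = id) (hTadd : ∀ a b : Fin d → ℤ, T (a + b) = T a ∘ T b)
    {P : Measure (Ω × (ℤ → {z // z ∈ Rng}))} [IsProbabilityMeasure P]
    (hP : MeasurePreserving (Sbi T Rng) P P)
    {μm : Measure (Ω × (ℕ → {z // z ∈ Rng}))} (hμm : μm = P.map (bwdRestrict Rng))
    (q : Kernel (Ω × (ℕ → {z // z ∈ Rng})) (Ω × (ℕ → {z // z ∈ Rng}))) [IsMarkovKernel q]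
    (hqsupp : ∀ᵐ η ∂μm, q η {ζ | ∃ z, ζ = SnegStep T Rng z η} = 1)
    (hqinv : μm.bind (fun η => q η) = μm) :
    μm ⊗ₘ q = (P.map fun η => (bwdRestrict Rng η, η.2 1)).map (SnegPair T Rng) := by
  have : IsProbabilityMeasure μm := by
    rw [hμm]
    exact Measure.isProbabilityMeasure_map measurable_bwdRestrict.aemeasurable
  have hW : Measurable fun η : Ω × (ℤ → {z // z ∈ Rng}) => (bwdRestrict Rng η, η.2 1) :=
    measurable_bwdRestrict.prodMk (by fun_prop)
  have hg := measurable_SnegUndo (Rng := Rng) hT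
  have hset : MeasurableSet {p : (Ω × (ℕ → {z // z ∈ Rng})) × (Ω × (ℕ → {z // z ∈ Rng})) |
      p.1 = SnegUndo T Rng p.2} :=
    measurableSet_eq_fun measurable_fst (hg.comp measurable_snd)
  have h1 : ∀ᵐ p ∂(μm ⊗ₘ q), p.1 = SnegUndo T Rng p.2 := by
    refine Measure.ae_compProd_of_ae_ae hset ?_
    filter_upwards [hqsupp] with η hη
    have hfin : MeasurableSet {ζ | ∃ z, ζ = SnegStep T Rng z η} := by
      refine Set.Finite.measurableSet ((Set.finite_range fun z => SnegStep T Rng z η).subset ?_)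
      rintro ζ ⟨z, rfl⟩
      exact ⟨z, rfl⟩
    filter_upwards [(mem_ae_iff_prob_eq_one hfin).2 hη] with ζ hζ
    obtain ⟨z, rfl⟩ := hζ
    rw [SnegUndo_SnegStep hT0 hTadd]
  have hcomp : (P.map fun η => (bwdRestrict Rng η, η.2 1)).map (SnegPair T Rng)
      = P.map fun η => (bwdRestrict Rng η, bwdRestrict Rng (Sbi T Rng η)) := by
    rw [Measure.map_map (measurable_SnegPair hT) hW]
    congr 1
    funext η
    rw [bwdRestrict_Sbi]
    rfl
  have hW' : Measurable fun η : Ω × (ℤ → {z // z ∈ Rng}) =>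
      (bwdRestrict Rng η, bwdRestrict Rng (Sbi T Rng η)) :=
    measurable_bwdRestrict.prodMk (measurable_bwdRestrict.comp (measurable_Sbi hT))
  rw [hcomp]
  have h2 : ∀ᵐ p ∂(P.map fun η => (bwdRestrict Rng η, bwdRestrict Rng (Sbi T Rng η))),
      p.1 = SnegUndo T Rng p.2 := by
    rw [ae_map_iff hW'.aemeasurable hset]
    refine ae_of_all _ fun η => ?_
    change bwdRestrict Rng η = SnegUndo T Rng (bwdRestrict Rng (Sbi T Rng η))
    rw [bwdRestrict_Sbi, SnegUndo_SnegStep hT0 hTadd]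
  rw [map_eq_map_snd_of_ae_eq hg h1, map_eq_map_snd_of_ae_eq hg h2, Measure.snd_compProd,
    Measure.snd_map_prodMk measurable_bwdRestrict]
  congr 1
  refine hqinv.trans (hμm.trans ?_)
  conv_lhs => rw [← hP.map_eq, Measure.map_map measurable_bwdRestrict (measurable_Sbi hT)]
  rfl

variable {P : Measure (Ω × (ℤ → {z // z ∈ Rng}))}

lemma ae_pathProb_ne_zero_iff (hT0 : T 0 = id)
    (hTadd : ∀ a b : Fin d → ℤ, T (a + b) = T a ∘ T b)
    (hP : MeasurePreserving (Sbi T Rng) P P) {n : ℕ} (hn : 0 < n) :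
    (∀ᵐ η ∂P, pathProb T prob n (fwdPath Rng n η) ≠ 0) ↔ ∀ᵐ η ∂P, stepProb prob η ≠ 0 := by
  simp_rw [pathProb_fwdPath hT0 hTadd, Finset.prod_ne_zero_iff]
  refine ⟨fun h => h.mono fun η hη => hη 0 (Finset.mem_range.2 hn), fun h => ?_⟩
  have hk : ∀ k, ∀ᵐ η ∂P, stepProb prob ((Sbi T Rng)^[k] η) ≠ 0 := fun k =>
    (hP.iterate k).quasiMeasurePreserving.ae h
  exact (ae_all_iff.2 hk).mono fun η hη k _ => hη k

lemma neg_log_pathProb_ae_eq (hT0 : T 0 = id)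
    (hTadd : ∀ a b : Fin d → ℤ, T (a + b) = T a ∘ T b)
    (hP : MeasurePreserving (Sbi T Rng) P P)
    (hprobsum : ∀ ω, ∑ z : {z // z ∈ Rng}, prob z ω = 1)
    (h : ∀ᵐ η ∂P, stepProb prob η ≠ 0) (n : ℕ) :
    (fun η => - Real.log (pathProb T prob n (fwdPath Rng n η)).toReal) =ᵐ[P]
      fun η => ∑ k ∈ Finset.range n,
        - Real.log (stepProb prob ((Sbi T Rng)^[k] η)).toReal := by
  have hk : ∀ k, ∀ᵐ η ∂P, stepProb prob ((Sbi T Rng)^[k] η) ≠ 0 := fun k =>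
    (hP.iterate k).quasiMeasurePreserving.ae h
  filter_upwards [ae_all_iff.2 hk] with η hη
  rw [pathProb_fwdPath hT0 hTadd, ENNReal.toReal_prod, Real.log_prod, Finset.sum_neg_distrib]
  exact fun k _ => (ENNReal.toReal_pos (hη k)
    (ne_top_of_le_ne_top ENNReal.one_ne_top (transition_le_one hprobsum _ _))).ne'

lemma integrable_neg_log_pathProb_iff (hT0 : T 0 = id)
    (hTadd : ∀ a b : Fin d → ℤ, T (a + b) = T a ∘ T b)
    (hP : MeasurePreserving (Sbi T Rng) P P)
    (hprob : ∀ z, Measurable (prob z))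
    (hprobsum : ∀ ω, ∑ z : {z // z ∈ Rng}, prob z ω = 1)
    (h : ∀ᵐ η ∂P, stepProb prob η ≠ 0) {n : ℕ} (hn : 0 < n) :
    Integrable (fun η => - Real.log (pathProb T prob n (fwdPath Rng n η)).toReal) P
      ↔ Integrable (fun η => - Real.log (stepProb prob η).toReal) P := by
  rw [integrable_congr (neg_log_pathProb_ae_eq hT0 hTadd hP hprobsum h n)]
  have hm : Measurable fun η => - Real.log (stepProb prob η).toReal :=
    (Real.measurable_log.comp (measurable_stepProb hprob).ennreal_toReal).neg
  refine ⟨fun hi => hi.mono' hm.aestronglyMeasurable (ae_of_all _ fun η => ?_), fun hi => ?_⟩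
  · rw [Real.norm_of_nonneg (neg_log_stepProb_nonneg hprobsum η)]
    exact Finset.single_le_sum
      (f := fun k => - Real.log (stepProb prob ((Sbi T Rng)^[k] η)).toReal)
      (fun k _ => neg_log_stepProb_nonneg hprobsum _) (Finset.mem_range.2 hn)
  · exact integrable_finsetSum _ fun k _ => (hP.iterate k).integrable_comp_of_integrable hi

lemma integral_neg_log_pathProb (hT0 : T 0 = id)
    (hTadd : ∀ a b : Fin d → ℤ, T (a + b) = T a ∘ T b)
    (hP : MeasurePreserving (Sbi T Rng) P P)
    (hprobsum : ∀ ω, ∑ z : {z // z ∈ Rng}, prob z ω = 1)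
    (h : ∀ᵐ η ∂P, stepProb prob η ≠ 0)
    (hi : Integrable (fun η => - Real.log (stepProb prob η).toReal) P) (n : ℕ) :
    ∫ η, - Real.log (pathProb T prob n (fwdPath Rng n η)).toReal ∂P
      = n * ∫ η, - Real.log (stepProb prob η).toReal ∂P := by
  rw [integral_congr_ae (neg_log_pathProb_ae_eq hT0 hTadd hP hprobsum h n),
    integral_finsetSum (f := fun k η => - Real.log (stepProb prob ((Sbi T Rng)^[k] η)).toReal) _
      fun k _ => (hP.iterate k).integrable_comp_of_integrable hi]
  have hk : ∀ k, ∫ η, - Real.log (stepProb prob ((Sbi T Rng)^[k] η)).toReal ∂P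
      = ∫ η, - Real.log (stepProb prob η).toReal ∂P := fun k => by
    have hae : AEStronglyMeasurable (fun η => - Real.log (stepProb prob η).toReal)
        (P.map (Sbi T Rng)^[k]) := by
      rw [(hP.iterate k).map_eq]
      exact hi.aestronglyMeasurable
    rw [← integral_map (hP.iterate k).measurable.aemeasurable hae, (hP.iterate k).map_eq]
  simp [hk]

end TransitionProbabilities

/-- Specific relative entropy representation (Lemma 2.4 of
Rassoul-Agha–Seppäläinen): for an `S⁺`-invariant probability measure `μ` on
`Ω_+ = Ω × R^ℕ` with `S`-invariant bi-infinite extension `μ̄`, backward marginal `μ₋`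
and conditional-step kernel `q_μ` (the unique Markov kernel supported on shifts fixing
`μ₋`), the limit `lim n⁻¹ H_{G_{1,n}}(μ | μ₀ × P₀^·)` exists and equals
`H(μ₋ × q_μ | μ₋ × p⁻)`. -/
theorem specific_entropy_limit
    {Ω : Type*} [MeasurableSpace Ω] [TopologicalSpace Ω] [PolishSpace Ω] [BorelSpace Ω]
    {d : ℕ} (T : (Fin d → ℤ) → Ω → Ω)
    (hT0 : T 0 = id)
    (hTadd : ∀ a b : Fin d → ℤ, T (a + b) = T a ∘ T b)
    (hTcont : ∀ a, Continuous (T a))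
    (Rng : Finset (Fin d → ℤ))
    -- transition probabilities `π_{0,z}(ω)`, continuous in `ω`
    (prob : {z // z ∈ Rng} → Ω → ℝ≥0∞)
    (hprobcont : ∀ z, Continuous (prob z))
    (hprobsum : ∀ ω, ∑ z : {z // z ∈ Rng}, prob z ω = 1)
    -- the quenched path kernel `P₀^ω`, characterized by its cylinder probabilities
    (K : Kernel Ω (ℕ → {z // z ∈ Rng})) [IsMarkovKernel K]
    (hK : ∀ (ω : Ω) (n : ℕ) (a : Fin n → {z // z ∈ Rng}),
      K ω {z | ∀ i : Fin n, z i = a i}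
        = ∏ i : Fin n,
            prob (a i) (T (∑ j ∈ Finset.univ.filter (· < i), (a j : Fin d → ℤ)) ω))
    -- the kernel `p⁻` on backward configurations
    (pneg : Kernel (Ω × (ℕ → {z // z ∈ Rng})) (Ω × (ℕ → {z // z ∈ Rng})))
    (hpneg : ∀ η, pneg η
        = ∑ z : {z // z ∈ Rng}, (prob z η.1) • Measure.dirac (SnegStep T Rng z η))
    -- an `S⁺`-invariant `μ`, its `S`-invariant extension `μ̄`, and backward marginal
    (μ : Measure (Ω × (ℕ → {z // z ∈ Rng}))) [IsProbabilityMeasure μ]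
    (hμinv : μ.map (Splus T Rng) = μ)
    (μbar : Measure (Ω × (ℤ → {z // z ∈ Rng}))) [IsProbabilityMeasure μbar]
    (hμbarinv : μbar.map (Sbi T Rng) = μbar)
    (hμbarfwd : μbar.map (fwdRestrict Rng) = μ)
    (μm : Measure (Ω × (ℕ → {z // z ∈ Rng})))
    (hμm : μm = μbar.map (bwdRestrict Rng))
    -- the kernel `q_μ`: Markov, supported on the shifts, fixing `μ₋`
    (q : Kernel (Ω × (ℕ → {z // z ∈ Rng})) (Ω × (ℕ → {z // z ∈ Rng})))
    [IsMarkovKernel q]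
    (hqsupp : ∀ᵐ η ∂μm, q η {ζ | ∃ z, ζ = SnegStep T Rng z η} = 1)
    (hqinv : μm.bind (fun η => q η) = μm) :
    Tendsto
      (fun n : ℕ =>
        (((n : ℝ)⁻¹ : ℝ) : EReal) *
          relEnt (μ.map (truncPath Rng n))
            (((μ.map Prod.fst) ⊗ₘ K).map (truncPath Rng n)))
      atTop
      (nhds (relEnt (μm ⊗ₘ q) (μm ⊗ₘ pneg))) := by
  classical
  have hT : ∀ a, Measurable (T a) := fun a => (hTcont a).measurable
  have hprob : ∀ z, Measurable (prob z) := fun z => (hprobcont z).measurable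
  have hP : MeasurePreserving (Sbi T Rng) μbar μbar := ⟨measurable_Sbi hT, hμbarinv⟩
  have hne : Nonempty (Ω × (ℤ → {z // z ∈ Rng})) := nonempty_of_isProbabilityMeasure μbar
  have : Nonempty {z // z ∈ Rng} := hne.map fun η => η.2 0
  have hμtrunc : ∀ n, μ.map (truncPath Rng n) = μbar.map (fwdPath Rng n) := fun n => by
    rw [← hμbarfwd, Measure.map_map (measurable_truncPath n) measurable_fwdRestrict,
      truncPath_comp_fwdRestrict]
  have hfst : ∀ n, μ.map Prod.fst = (μbar.map (fwdPath Rng n)).fst := fun n => by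
    rw [← hμtrunc, Measure.fst, Measure.map_map measurable_fst (measurable_truncPath n)]
    rfl
  have hW : Measurable fun η : Ω × (ℤ → {z // z ∈ Rng}) => (bwdRestrict Rng η, η.2 1) :=
    measurable_bwdRestrict.prodMk (by fun_prop)
  have hfstm : (μbar.map fun η => (bwdRestrict Rng η, η.2 1)).fst = μm := by
    rw [Measure.fst_map_prodMk (by fun_prop), hμm]
  have : IsProbabilityMeasure μm := by
    rw [hμm]
    exact Measure.isProbabilityMeasure_map measurable_bwdRestrict.aemeasurable
  have : IsMarkovKernel pneg := ⟨fun η => ⟨by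
    rw [hpneg, Measure.finsetSum_apply]
    simpa using hprobsum η.1⟩⟩
  have hρ : Measurable fun x : (Ω × (ℕ → {z // z ∈ Rng})) × {z // z ∈ Rng} => prob x.2 x.1.1 :=
    measurable_from_prod_countable_left fun z => (hprob z).comp measurable_fst
  have hleft : ∀ n, relEnt (μ.map (truncPath Rng n))
      (((μ.map Prod.fst) ⊗ₘ K).map (truncPath Rng n))
      = relEnt (μbar.map (fwdPath Rng n))
        (((μbar.map (fwdPath Rng n)).fst.prod Measure.count).withDensity (pathProb T prob n)) :=
    fun n => by rw [map_truncPath_compProd _ K hK, hμtrunc, hfst n]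
  have : IsFiniteMeasure ((μm.prod (Measure.count : Measure {z // z ∈ Rng})).withDensity
      fun x => prob x.2 x.1.1) :=
    isFiniteMeasure_withDensity_of_le_one _ fun _ => transition_le_one hprobsum _ _
  have hright : relEnt (μm ⊗ₘ q) (μm ⊗ₘ pneg)
      = if ∀ᵐ η ∂μbar, stepProb prob η ≠ 0 then
          if Integrable (fun η => - Real.log (stepProb prob η).toReal) μbar then
            ((condNegEntropy (μbar.map fun η => (bwdRestrict Rng η, η.2 1))
              + ∫ η, - Real.log (stepProb prob η).toReal ∂μbar : ℝ) : EReal)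
          else 0
        else ⊤ := by
    rw [compProd_eq_map_bwdRestrict hT hT0 hTadd hP hμm q hqsupp hqinv,
      compProd_eq_map_SnegPair hT hprob μm pneg hpneg,
      relEnt_map_of_measurableEmbedding _ _ (measurableEmbedding_SnegPair hT), ← hfstm]
    exact relEnt_map_withDensity_fst_prod_count μbar hW hρ fun x => transition_le_one hprobsum _ _
  rw [hright]
  simp_rw [hleft, relEnt_map_withDensity_fst_prod_count μbar (measurable_fwdPath _)
    (measurable_pathProb hT hprob _) (pathProb_le_one hprobsum _)]
  by_cases h : ∀ᵐ η ∂μbar, stepProb prob η ≠ 0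
  swap
  · rw [if_neg h]
    refine tendsto_const_nhds.congr' ?_
    filter_upwards [eventually_gt_atTop 0] with n hn
    rw [if_neg ((ae_pathProb_ne_zero_iff hT0 hTadd hP hn).not.2 h),
      EReal.coe_mul_top_of_pos (by positivity)]
  rw [if_pos h]
  by_cases hi : Integrable (fun η => - Real.log (stepProb prob η).toReal) μbar
  swap
  · rw [if_neg hi]
    refine tendsto_const_nhds.congr' ?_
    filter_upwards [eventually_gt_atTop 0] with n hn
    rw [if_pos ((ae_pathProb_ne_zero_iff hT0 hTadd hP hn).2 h), if_neg
      ((integrable_neg_log_pathProb_iff hT0 hTadd hP hprob hprobsum h hn).not.2 hi), mul_zero]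
  rw [if_pos hi]
  refine (EReal.tendsto_coe.2 ((tendsto_condNegEntropy_fwdPath hT hT0 hTadd hP).add_const
    (∫ η, - Real.log (stepProb prob η).toReal ∂μbar))).congr' ?_
  filter_upwards [eventually_gt_atTop 0] with n hn
  rw [if_pos ((ae_pathProb_ne_zero_iff hT0 hTadd hP hn).2 h), if_pos
    ((integrable_neg_log_pathProb_iff hT0 hTadd hP hprob hprobsum h hn).2 hi),
    integral_neg_log_pathProb hT0 hTadd hP hprobsum h hi, ← EReal.coe_mul, mul_add,
    inv_mul_cancel_left₀ (by positivity)]
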